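/- Consider lists over the type D = Fin 3 × Bool (the six signed axis directions +X, −X, +Y, −Y, +Z, −Z, where the first component is the axis and the second is the sign) satisfying: (i) the list has length at least 3, (ii) the list has no duplicate entries, and (iii) any two cyclically adjacent entries (including the last and the first) have distinct first components (distinct axes). Then the number of equivalence classes of such lists under cyclic rotation (List.IsRotated) is exactly 126. -/

import Mathlib

/-- A polycube corner configuration: a list over the six signed axis directions
`Fin 3 × Bool` of length at least 3, without duplicate entries, in which any two
cyclically adjacent entries have distinct axes (distinct first components). -/
def IsPolycubeCorner (l : List (Fin 3 × Bool)) : Prop :=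
  3 ≤ l.length ∧ l.Nodup ∧
    ∀ l' : List (Fin 3 × Bool), l.IsRotated l' →
      l'.Chain' (fun a b => a.1 ≠ b.1)

def pcDirs : List (Fin 3 × Bool) :=
  [(0, true), (0, false), (1, true), (1, false), (2, true), (2, false)]

def pcCode (x : Fin 3 × Bool) : ℕ := 2 * x.1.val + (if x.2 then 0 else 1)

def pcOk (x : Fin 3 × Bool) (l : List (Fin 3 × Bool)) : Bool :=
  decide (x ∉ l) && (match l with
    | [] => true
    | y :: _ => decide (x.1 ≠ y.1))

def pcGen : ℕ → List (List (Fin 3 × Bool))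
  | 0 => [[]]
  | n + 1 => (pcGen n).flatMap fun l => (pcDirs.filter fun x => pcOk x l).map fun x => x :: l

def pcCyc (l : List (Fin 3 × Bool)) : Bool :=
  decide (∀ r ∈ l.cyclicPermutations, r.IsChain (fun a b => a.1 ≠ b.1))

def pcCanon (l : List (Fin 3 × Bool)) : Bool :=
  match l with
  | [] => true
  | y :: t => decide (∀ x ∈ t, pcCode y ≤ pcCode x)

def pcAll : List (List (Fin 3 × Bool)) :=
  (pcGen 3 ++ pcGen 4 ++ pcGen 5 ++ pcGen 6).filter pcCyc

def pcReps : List (List (Fin 3 × Bool)) := pcAll.filter pcCanon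

lemma pc_mem_gen (l : List (Fin 3 × Bool)) (hn : l.Nodup)
    (hc : l.IsChain (fun a b => a.1 ≠ b.1)) : l ∈ pcGen l.length := by
  induction l with
  | nil => simp [pcGen]
  | cons x t ih =>
    have hn' := List.nodup_cons.1 hn
    simp only [List.length_cons, pcGen, List.mem_flatMap, List.mem_map, List.mem_filter]
    refine ⟨t, ih hn'.2 hc.tail, x, ⟨?_, ?_⟩, rfl⟩
    · exact (by decide : ∀ z : Fin 3 × Bool, z ∈ pcDirs) x
    · cases t with
      | nil => simp [pcOk]
      | cons y s =>
        have := (List.isChain_cons_cons.1 hc).1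
        simp only [pcOk, Bool.and_eq_true, decide_eq_true_eq]
        exact ⟨hn'.1, this⟩

lemma pc_corner_mem (l : List (Fin 3 × Bool)) (h : IsPolycubeCorner l) : l ∈ pcAll := by
  obtain ⟨h3, hn, hc⟩ := h
  have h6 : l.length ≤ 6 := by simpa using hn.length_le_card
  have hg := pc_mem_gen l hn (hc l (List.IsRotated.refl l))
  refine List.mem_filter.2 ⟨?_, ?_⟩
  · simp only [List.mem_append]
    generalize l.length = n at *
    interval_cases n <;> simp [hg]
  · simp only [pcCyc, decide_eq_true_eq]
    intro r hr
    exact hc r (List.mem_cyclicPermutations_iff.1 hr).symm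

set_option maxRecDepth 100000 in
lemma pc_all_prop : ∀ l ∈ pcAll, 3 ≤ l.length ∧ l.Nodup ∧
    ∃ r ∈ l.cyclicPermutations, pcCanon r = true := by decide +kernel

set_option maxRecDepth 100000 in
lemma pc_reps_inj : ∀ l ∈ pcReps, ∀ r ∈ l.cyclicPermutations, pcCanon r = true → r = l := by
  decide +kernel

set_option maxRecDepth 100000 in
lemma pc_reps_card : pcReps.toFinset.card = 126 := by decide +kernel

lemma pc_mem_corner (l : List (Fin 3 × Bool)) (h : l ∈ pcAll) : IsPolycubeCorner l := by
  refine ⟨(pc_all_prop l h).1, (pc_all_prop l h).2.1, fun r hr => ?_⟩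
  have := (List.mem_filter.1 h).2
  simp only [pcCyc, decide_eq_true_eq] at this
  exact this r (List.mem_cyclicPermutations_iff.2 hr.symm)

/-- There are exactly 126 polycube corner configurations up to cyclic rotation. -/
theorem card_polycube_corners_eq_126 :
    Nat.card (Quotient (Setoid.comap
      (fun l : {l : List (Fin 3 × Bool) // IsPolycubeCorner l} => l.val)
      (List.IsRotated.setoid (Fin 3 × Bool)))) = 126 := by
  let f : {l // l ∈ pcReps.toFinset} → Quotient (Setoid.comap
      (fun l : {l : List (Fin 3 × Bool) // IsPolycubeCorner l} => l.val)
      (List.IsRotated.setoid (Fin 3 × Bool))) := fun l =>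
    Quotient.mk _ ⟨l.1, pc_mem_corner l.1 (List.mem_filter.1 (List.mem_toFinset.1 l.2)).1⟩
  have hf : Function.Bijective f := by
    constructor
    · rintro ⟨a, ha⟩ ⟨b, hb⟩ hab
      have hr : a.IsRotated b := Quotient.exact hab
      rw [List.mem_toFinset] at ha hb
      apply Subtype.ext
      exact (pc_reps_inj a ha b (List.mem_cyclicPermutations_iff.2 hr.symm)
        (List.mem_filter.1 hb).2).symm
    · intro q
      induction q using Quotient.inductionOn with
      | h l =>
        obtain ⟨l, hl⟩ := l
        obtain ⟨h3, hn, r, hr, hcan⟩ := pc_all_prop l (pc_corner_mem l hl)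
        have hrot : r.IsRotated l := List.mem_cyclicPermutations_iff.1 hr
        have hrc : IsPolycubeCorner r :=
          ⟨hrot.perm.length_eq ▸ h3, hrot.nodup_iff.2 hn,
            fun s hs => hl.2.2 s (hrot.symm.trans hs)⟩
        refine ⟨⟨r, List.mem_toFinset.2 (List.mem_filter.2 ⟨pc_corner_mem r hrc, hcan⟩)⟩, ?_⟩
        exact Quotient.sound hrot
  rw [← Nat.card_congr (Equiv.ofBijective f hf), Nat.card_eq_fintype_card, Fintype.card_coe,
    pc_reps_card]
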